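/- Fix integers m ≥ 2 and k with 1 ≤ k ≤ m, and let 0 ≤ r ≤ k − 1. Then the number of code words of length k over base dimension m whose last set A_k has cardinality r equals the unsigned Stirling number of the first kind c(k, r+1), i.e., it equals the number of permutations of a k-element set having exactly r + 1 cycles, where fixed points are counted as cycles of length 1 (equivalently, permutations of {1, …, k} whose action has exactly r + 1 orbits). -/

import Mathlib

/-- A code word of length `k` over base dimension `m`: a sequence
`A 1, A 2, …, A k` of finite sets of integers, each contained in `{2, 3, …}`,
such that `A 1 = ∅`, for each `2 ≤ j ≤ k` we have `A j ⊆ A (j-1) ∪ {j}`,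
and `|A j| ≤ m - 1` for all `j`.  (We normalize `A i = ∅` outside `1 ≤ i ≤ k`.) -/
def IsCodeWord (m k : ℕ) (A : ℕ → Finset ℕ) : Prop :=
  A 1 = ∅ ∧
  (∀ i, 1 ≤ i → i ≤ k → ∀ x ∈ A i, 2 ≤ x) ∧
  (∀ j, 2 ≤ j → j ≤ k → A j ⊆ A (j - 1) ∪ {j}) ∧
  (∀ i, 1 ≤ i → i ≤ k → (A i).card ≤ m - 1) ∧
  (∀ i, i = 0 ∨ k < i → A i = ∅)

/-- `multCW k A j` is `n_j`: the number of indices `i` (with `1 ≤ i ≤ k`)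
such that `j ∈ A i`. -/
def multCW (k : ℕ) (A : ℕ → Finset ℕ) (j : ℕ) : ℕ :=
  ((Finset.Icc 1 k).filter (fun i => j ∈ A i)).card

/-- `N m k r` is the number of code words of length `k` over base dimension `m`
whose last set `A k` has cardinality `r`. -/
noncomputable def N (m k r : ℕ) : ℕ :=
  {A : ℕ → Finset ℕ | IsCodeWord m k A ∧ (A k).card = r}.ncard

/-- The number of orbits of the action of the cyclic group generated by a
permutation `σ` of `Fin k` on `Fin k`; equivalently, the number of cycles of
`σ`, where fixed points count as cycles of length 1. -/
noncomputable def orbitCount {k : ℕ} (σ : Equiv.Perm (Fin k)) : ℕ :=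
  Nat.card (Quotient (MulAction.orbitRel (Subgroup.zpowers σ) (Fin k)))

open Polynomial in
/-- The polynomial `∑_{a ∈ s} X ^ w a` counts the elements of `s` by weight. -/
theorem coeff_sum_X_pow {ι : Type*} (s : Finset ι) (w : ι → ℕ) (n : ℕ) :
    (∑ a ∈ s, (X : ℤ[X]) ^ w a).coeff n = (s.filter (fun a => w a = n)).card := by
  simp [coeff_X_pow, eq_comm]

/-! ### Code words -/

open Classical in
/-- The words of length `k + 1` subject to no cardinality bound. -/
noncomputable def codeWords : ℕ → Finset (ℕ → Finset ℕ)
  | 0 => {fun _ => ∅}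
  | k + 1 => ((codeWords k).sigma fun A => (insert (k + 2) (A (k + 1))).powerset).image
      fun p => Function.update p.1 (k + 2) p.2

theorem IsCodeWord.subset_Icc {m k : ℕ} {A : ℕ → Finset ℕ} (hA : IsCodeWord m k A) {j : ℕ}
    (hj : 1 ≤ j) (hjk : j ≤ k) : A j ⊆ Finset.Icc 2 j := by
  induction j, hj using Nat.le_induction with
  | base => simp [hA.1]
  | succ j hj ih =>
    intro x hx
    have hx2 := hA.2.1 (j + 1) (by omega) hjk x hx
    have hx' := hA.2.2.1 (j + 1) (by omega) hjk hx
    simp only [Nat.add_sub_cancel, Finset.mem_union, Finset.mem_singleton] at hx'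
    rcases hx' with hx' | rfl
    · have := Finset.mem_Icc.1 (ih (by omega) hx')
      exact Finset.mem_Icc.2 ⟨hx2, by omega⟩
    · exact Finset.mem_Icc.2 ⟨hx2, le_rfl⟩

theorem isCodeWord_one_iff {m : ℕ} {A : ℕ → Finset ℕ} :
    IsCodeWord m 1 A ↔ A = fun _ => ∅ := by
  constructor
  · intro hA
    funext i
    by_cases hi : i = 1
    · rw [hi, hA.1]
    · exact hA.2.2.2.2 i (by omega)
  · rintro rfl
    simp [IsCodeWord]

theorem IsCodeWord.update {m k : ℕ} {A : ℕ → Finset ℕ} (hA : IsCodeWord m (k + 1) A)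
    (hkm : k + 2 ≤ m) {S : Finset ℕ} (hS : S ⊆ insert (k + 2) (A (k + 1))) :
    IsCodeWord m (k + 2) (Function.update A (k + 2) S) := by
  have hS' : S ⊆ Finset.Icc 2 (k + 2) := by
    intro x hx
    rcases Finset.mem_insert.1 (hS hx) with rfl | hx
    · simp
    · have := Finset.mem_Icc.1 (hA.subset_Icc (by omega) le_rfl hx)
      exact Finset.mem_Icc.2 ⟨this.1, by omega⟩
  obtain ⟨h1, h2, h3, h4, h5⟩ := hA
  refine ⟨by simpa using h1, fun i hi hik x hx => ?_, fun j hj hjk => ?_, fun i hi hik => ?_,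
    fun i hi => ?_⟩
  · rcases eq_or_ne i (k + 2) with rfl | hne
    · rw [Function.update_self] at hx
      exact (Finset.mem_Icc.1 (hS' hx)).1
    · rw [Function.update_of_ne hne] at hx
      exact h2 i hi (by omega) x hx
  · rw [Function.update_of_ne (show j - 1 ≠ k + 2 by omega)]
    rcases eq_or_ne j (k + 2) with rfl | hne
    · rw [Function.update_self, Finset.union_comm]
      exact hS
    · rw [Function.update_of_ne hne]
      exact h3 j hj (by omega)
  · rcases eq_or_ne i (k + 2) with rfl | hne
    · rw [Function.update_self]
      have := Finset.card_le_card hS'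
      rw [Nat.card_Icc] at this
      omega
    · rw [Function.update_of_ne hne]
      exact h4 i hi (by omega)
  · rw [Function.update_of_ne (by omega)]
    exact h5 i (by omega)

theorem IsCodeWord.truncate {m k : ℕ} {A : ℕ → Finset ℕ} (hA : IsCodeWord m (k + 2) A) :
    IsCodeWord m (k + 1) (Function.update A (k + 2) ∅) := by
  obtain ⟨h1, h2, h3, h4, h5⟩ := hA
  refine ⟨by simpa using h1, fun i hi hik => ?_, fun j hj hjk => ?_, fun i hi hik => ?_,
    fun i hi => ?_⟩
  · rw [Function.update_of_ne (by omega)]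
    exact h2 i hi (by omega)
  · rw [Function.update_of_ne (by omega), Function.update_of_ne (by omega)]
    exact h3 j hj (by omega)
  · rw [Function.update_of_ne (by omega)]
    exact h4 i hi (by omega)
  · rcases eq_or_ne i (k + 2) with rfl | hne
    · rw [Function.update_self]
    · rw [Function.update_of_ne hne]
      exact h5 i (by omega)

theorem mem_codeWords_iff {m k : ℕ} (hkm : k + 1 ≤ m) {A : ℕ → Finset ℕ} :
    A ∈ codeWords k ↔ IsCodeWord m (k + 1) A := by
  induction k generalizing A with
  | zero => rw [codeWords, Finset.mem_singleton, isCodeWord_one_iff]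
  | succ k ih =>
    simp only [codeWords, Finset.mem_image, Finset.mem_sigma, Finset.mem_powerset, Sigma.exists]
    constructor
    · rintro ⟨B, S, ⟨hB, hS⟩, rfl⟩
      exact ((ih (by omega)).1 hB).update hkm hS
    · intro hA
      refine ⟨Function.update A (k + 2) ∅, A (k + 2), ⟨(ih (by omega)).2 hA.truncate, ?_⟩,
        by simp⟩
      rw [Function.update_of_ne (by omega)]
      have := hA.2.2.1 (k + 2) (by omega) le_rfl
      rwa [Finset.union_comm] at this

theorem injOn_update_codeWords (k : ℕ) :
    Set.InjOn (fun p : (_ : ℕ → Finset ℕ) × Finset ℕ => Function.update p.1 (k + 2) p.2)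
      ((codeWords k).sigma fun A => (insert (k + 2) (A (k + 1))).powerset) := by
  rintro ⟨A, S⟩ hA ⟨B, T⟩ hB h
  simp only [Finset.coe_sigma, Set.mem_sigma_iff, Finset.mem_coe,
    mem_codeWords_iff (le_refl (k + 1))] at hA hB h
  have hST : S = T := by simpa using congrFun h (k + 2)
  have hAB : A = B := by
    funext i
    rcases eq_or_ne i (k + 2) with rfl | hne
    · rw [hA.1.2.2.2.2 _ (by omega), hB.1.2.2.2.2 _ (by omega)]
    · simpa [hne] using congrFun h i
  rw [hAB, hST]

open Polynomial Classical in
theorem sum_codeWords_X_pow (k : ℕ) :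
    ∑ A ∈ codeWords k, (X : ℤ[X]) ^ ((A (k + 1)).card + 1) = ascPochhammer ℤ (k + 1) := by
  induction k with
  | zero => simp [codeWords]
  | succ k ih =>
    rw [ascPochhammer_succ_left, ← ih, codeWords, Finset.sum_image (injOn_update_codeWords k),
      Finset.sum_sigma, Polynomial.sum_comp, Finset.mul_sum]
    refine Finset.sum_congr rfl fun A hA => ?_
    have hA' := (mem_codeWords_iff (le_refl (k + 1))).1 hA
    have hnot : k + 2 ∉ A (k + 1) := fun h => by
      have := Finset.mem_Icc.1 (hA'.subset_Icc (by omega) le_rfl h)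
      omega
    have := Finset.sum_pow_mul_eq_add_pow (X : ℤ[X]) 1 (insert (k + 2) (A (k + 1)))
    simp only [one_pow, mul_one, Finset.card_insert_of_notMem hnot] at this
    simp only [Function.update_self, pow_succ', ← Finset.mul_sum, this, X_pow_comp, mul_comp,
      X_comp]

/-! ### Permutations -/

/-- Functions that are invariant under `σ` are the functions on the orbits of `σ`. -/
def invariantFunEquiv {α β : Type*} (σ : Equiv.Perm α) :
    {f : α → β // ∀ x, f (σ x) = f x} ≃
      (Quotient (MulAction.orbitRel (Subgroup.zpowers σ) α) → β) where
  toFun f := Quotient.lift f.1 (by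
    rintro _ x ⟨⟨g, hg⟩, rfl⟩
    obtain ⟨n, rfl⟩ := hg
    change f.1 ((σ ^ n) x) = f.1 x
    induction n with
    | zero => simp
    | succ n ih => rw [add_comm, zpow_add, zpow_one, Equiv.Perm.mul_apply, f.2, ih]
    | pred n ih => rw [← ih, ← f.2, ← Equiv.Perm.mul_apply, ← zpow_one_add, add_sub_cancel])
  invFun g := ⟨fun x => g (Quotient.mk _ x), fun x => congrArg g (Quotient.sound
    ⟨⟨σ, Subgroup.mem_zpowers σ⟩, rfl⟩)⟩
  left_inv f := rfl
  right_inv g := by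
    funext q
    induction q using Quotient.inductionOn
    rfl

theorem card_fixedBy_mk {k n : ℕ} (σ : Equiv.Perm (Fin k)) :
    Nat.card (MulAction.fixedBy (Fin k → Fin n) (DomMulAct.mk σ)) = n ^ orbitCount σ := by
  have e : MulAction.fixedBy (Fin k → Fin n) (DomMulAct.mk σ) ≃
      {f : Fin k → Fin n // ∀ x, f (σ x) = f x} :=
    Equiv.subtypeEquivRight fun f => funext_iff
  rw [Nat.card_congr (e.trans (invariantFunEquiv σ)), Nat.card_fun, Nat.card_fin, orbitCount]

theorem exists_perm_comp_eq_of_map_univ_eq {α β : Type*} [Fintype α] {f g : α → β}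
    (h : Finset.univ.val.map f = Finset.univ.val.map g) :
    ∃ σ : Equiv.Perm α, ∀ x, g (σ x) = f x := by
  classical
  have hcard (c : β) : Fintype.card {a // f a = c} = Fintype.card {a // g a = c} := by
    have := congrArg (Multiset.count c) h
    simpa [Multiset.count_map, Fintype.card_subtype, Finset.card_def, eq_comm] using this
  exact ⟨Equiv.ofFiberEquiv fun c => Fintype.equivOfCardEq (hcard c),
    Equiv.ofFiberEquiv_map _⟩

/-- The orbits of permutations acting on functions by precomposition are multisets of values. -/
theorem card_quotient_domMulAct_perm (k n : ℕ) :
    Nat.card (Quotient (MulAction.orbitRel (Equiv.Perm (Fin k))ᵈᵐᵃ (Fin k → Fin n))) =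
      n.multichoose k := by
  let F : Quotient (MulAction.orbitRel (Equiv.Perm (Fin k))ᵈᵐᵃ (Fin k → Fin n)) → Sym (Fin n) k :=
    Quotient.lift (fun f => ⟨Finset.univ.val.map f, by simp⟩) (by
      rintro _ f ⟨σ, rfl⟩
      apply Subtype.ext
      change Finset.univ.val.map (f ∘ (DomMulAct.mk.symm σ : Equiv.Perm (Fin k))) = _
      rw [← Multiset.map_map, Multiset.map_univ_val_equiv])
  have hF : Function.Bijective F := by
    constructor
    · intro p q
      induction p, q using Quotient.inductionOn₂ with | _ f g
      intro h
      obtain ⟨σ, hσ⟩ := exists_perm_comp_eq_of_map_univ_eq (f := f) (g := g)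
        (congrArg Subtype.val h)
      exact Quotient.sound ⟨DomMulAct.mk σ, funext hσ⟩
    · rintro ⟨s, rfl⟩
      induction s using Quotient.inductionOn with | _ l
      refine ⟨Quotient.mk _ l.get, Subtype.ext ?_⟩
      change (List.map l.get (List.finRange l.length) : Multiset (Fin n)) = l
      rw [List.map_get_finRange]
  rw [Nat.card_congr (Equiv.ofBijective F hF), Nat.card_eq_fintype_card,
    Sym.card_sym_eq_multichoose, Fintype.card_fin]

theorem sum_pow_orbitCount (k n : ℕ) :
    ∑ σ : Equiv.Perm (Fin k), n ^ orbitCount σ = n.ascFactorial k := by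
  classical
  have := Fintype.ofFinite (Quotient
    (MulAction.orbitRel (Equiv.Perm (Fin k))ᵈᵐᵃ (Fin k → Fin n)))
  have : Fintype (Equiv.Perm (Fin k))ᵈᵐᵃ := Fintype.ofEquiv _ DomMulAct.mk
  have burnside := MulAction.sum_card_fixedBy_eq_card_orbits_mul_card_group
    (Equiv.Perm (Fin k))ᵈᵐᵃ (Fin k → Fin n)
  rw [← Nat.card_eq_fintype_card, card_quotient_domMulAct_perm,
    ← Fintype.card_congr DomMulAct.mk, Fintype.card_perm, Fintype.card_fin,
    ← Equiv.sum_comp DomMulAct.mk] at burnside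
  simp only [← Nat.card_eq_fintype_card, card_fixedBy_mk] at burnside
  rw [burnside, Nat.ascFactorial_eq_factorial_mul_choose', Nat.multichoose_eq, mul_comm]

open Polynomial in
theorem sum_X_pow_orbitCount (k : ℕ) :
    ∑ σ : Equiv.Perm (Fin k), (X : ℤ[X]) ^ orbitCount σ = ascPochhammer ℤ k := by
  refine eq_of_infinite_eval_eq _ _ ((Set.infinite_range_of_injective
    (Nat.cast_injective (R := ℤ))).mono ?_)
  rintro _ ⟨n, rfl⟩
  simp only [Set.mem_ofPred_eq, eval_finsetSum, eval_pow, eval_X]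
  rw [ascPochhammer_nat_eq_natCast_ascFactorial, ← sum_pow_orbitCount]
  push_cast
  rfl

/-- For `1 ≤ k ≤ m` and `0 ≤ r ≤ k - 1`, the number of code words of length `k`
over base dimension `m` whose last set has cardinality `r` equals the unsigned
Stirling number of the first kind `c(k, r+1)`, i.e. the number of permutations
of a `k`-element set with exactly `r + 1` cycles (orbits). -/
theorem N_eq_stirling (m k r : ℕ) (hm : 2 ≤ m) (hk1 : 1 ≤ k) (hkm : k ≤ m)
    (hr : r ≤ k - 1) :
    N m k r = {σ : Equiv.Perm (Fin k) | orbitCount σ = r + 1}.ncard := by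
  classical
  obtain ⟨k, rfl⟩ := Nat.exists_eq_add_of_le' hk1
  have h := congrArg (fun p => p.coeff (r + 1))
    ((sum_codeWords_X_pow k).trans (sum_X_pow_orbitCount (k + 1)).symm)
  simp only [coeff_sum_X_pow, Nat.cast_inj, Nat.add_right_cancel_iff] at h
  have hN : {A | IsCodeWord m (k + 1) A ∧ (A (k + 1)).card = r} =
      ((codeWords k).filter fun A => (A (k + 1)).card = r : Finset _) := by
    ext A
    simp [mem_codeWords_iff hkm]
  have hP : {σ : Equiv.Perm (Fin (k + 1)) | orbitCount σ = r + 1} =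
      ((Finset.univ.filter fun σ => orbitCount σ = r + 1 : Finset (Equiv.Perm (Fin (k + 1)))) :
        Set (Equiv.Perm (Fin (k + 1)))) := by
    ext σ
    simp
  rw [N, hN, hP, Set.ncard_coe_finset, Set.ncard_coe_finset, h]
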